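/- Let K be a field, V a K-vector space of finite dimension r + 1 with r ≥ 1, and let t be a natural number with t ≥ r + 1. Let S and S′ be finite subsets of the projectivization ℙ(V), each of cardinality t and each in general linear position. If the set of submodules { span(A) : A ⊆ S, |A| = r } equals the set { span(A′) : A′ ⊆ S′, |A′| = r }, then S = S′. -/

import Mathlib

/-- The submodule of `V` spanned by the lines corresponding to a finite set of
points of the projectivization `ℙ K V`. -/
def pspan (K : Type*) {V : Type*} [Field K] [AddCommGroup V] [Module K V]
    (A : Finset (Projectivization K V)) : Submodule K V :=
  ⨆ P ∈ A, P.submodule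

/-- A finite set `S ⊆ ℙ K V` is in general linear position (with respect to `r`,
where `finrank K V = r + 1`) if every subset `T ⊆ S` with `|T| ≤ r + 1` spans a
submodule of dimension `|T|`. -/
def InGenLinPos (K : Type*) {V : Type*} [Field K] [AddCommGroup V] [Module K V]
    (r : ℕ) (S : Finset (Projectivization K V)) : Prop :=
  ∀ T ⊆ S, T.card ≤ r + 1 → Module.finrank K (pspan K T) = T.card

section GenLinPos

open Finset

variable {K V : Type*} [Field K] [AddCommGroup V] [Module K V]

lemma submodule_le_pspan {A : Finset (Projectivization K V)} {P : Projectivization K V}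
    (hP : P ∈ A) : P.submodule ≤ pspan K A :=
  le_biSup (fun P : Projectivization K V => P.submodule) hP

lemma pspan_mono {A B : Finset (Projectivization K V)} (h : A ⊆ B) : pspan K A ≤ pspan K B :=
  biSup_mono fun _ hP => h hP

lemma pspan_union [DecidableEq (Projectivization K V)] (A B : Finset (Projectivization K V)) :
    pspan K (A ∪ B) = pspan K A ⊔ pspan K B :=
  Finset.iSup_union

lemma pspan_singleton (P : Projectivization K V) : pspan K {P} = P.submodule := by
  simp [pspan]

lemma pspan_empty : pspan K (∅ : Finset (Projectivization K V)) = ⊥ := by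
  simp [pspan]

lemma eq_of_submodule_le {P Q : Projectivization K V} (h : Q.submodule ≤ P.submodule) :
    Q = P := by
  have : FiniteDimensional K P.submodule :=
    Module.finite_of_finrank_eq_succ (n := 0) P.finrank_submodule
  exact Projectivization.submodule_injective
    (Submodule.eq_of_le_of_finrank_eq h (by rw [P.finrank_submodule, Q.finrank_submodule]))

lemma not_submodule_le_bot (Q : Projectivization K V) : ¬ Q.submodule ≤ ⊥ := by
  intro h
  have h1 := Q.finrank_submodule
  rw [le_bot_iff.mp h, finrank_bot] at h1
  exact zero_ne_one h1

variable [FiniteDimensional K V] {r : ℕ} {S : Finset (Projectivization K V)}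

/-- Spans of subsets of a set in general linear position intersect in the expected span. -/
lemma InGenLinPos.pspan_inf [DecidableEq (Projectivization K V)] (hS : InGenLinPos K r S)
    {A B : Finset (Projectivization K V)} (hA : A ⊆ S) (hB : B ⊆ S) (hAB : #(A ∪ B) ≤ r + 1) :
    pspan K A ⊓ pspan K B = pspan K (A ∩ B) := by
  refine (Submodule.eq_of_le_of_finrank_eq
    (le_inf (pspan_mono inter_subset_left) (pspan_mono inter_subset_right)) ?_).symm
  have h1 := Submodule.finrank_sup_add_finrank_inf_eq (pspan K A) (pspan K B)
  have hA' := card_le_card (subset_union_left (s₁ := A) (s₂ := B))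
  have hB' := card_le_card (subset_union_right (s₁ := A) (s₂ := B))
  have hI := card_le_card (inter_subset_left (s₁ := A) (s₂ := B))
  have hcard := card_union_add_card_inter A B
  rw [← pspan_union, hS _ (union_subset hA hB) hAB, hS A hA (by omega),
    hS B hB (by omega)] at h1
  rw [hS _ (inter_subset_left.trans hA) (by omega)]
  omega

lemma InGenLinPos.submodule_le_pspan_iff (hS : InGenLinPos K r S)
    {A : Finset (Projectivization K V)} (hA : A ⊆ S) (hAr : #A ≤ r)
    {P : Projectivization K V} (hP : P ∈ S) : P.submodule ≤ pspan K A ↔ P ∈ A := by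
  classical
  refine ⟨fun h => ?_, submodule_le_pspan⟩
  by_contra hPA
  have hinf := hS.pspan_inf (singleton_subset_iff.mpr hP) hA
    ((card_union_le _ _).trans (by rw [card_singleton]; omega))
  rw [singleton_inter_of_notMem hPA, pspan_empty, pspan_singleton, inf_eq_left.mpr h] at hinf
  exact not_submodule_le_bot P hinf.le

lemma InGenLinPos.pspan_injOn (hS : InGenLinPos K r S) :
    Set.InjOn (pspan K) (powersetCard r S : Set (Finset (Projectivization K V))) := by
  intro A hA B hB hAB
  rw [mem_coe, mem_powersetCard] at hA hB
  ext P
  constructor <;> intro hP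
  · exact (hS.submodule_le_pspan_iff hB.1 hB.2.le (hA.1 hP)).mp (hAB ▸ submodule_le_pspan hP)
  · exact (hS.submodule_le_pspan_iff hA.1 hA.2.le (hB.1 hP)).mp (hAB ▸ submodule_le_pspan hP)

/-- A point outside `S` that lies on the span of some `r`-subset `A` admits two points of `A`
that cannot be exchanged for `P` without losing it. -/
lemma InGenLinPos.exists_nontrivial_support [DecidableEq (Projectivization K V)]
    (hS : InGenLinPos K r S) {Q P : Projectivization K V} (hQ : Q ∉ S) (hP : P ∈ S)
    {A : Finset (Projectivization K V)} (hA : A ⊆ S) (hAr : #A = r) (hPA : P ∉ A)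
    (hQA : Q.submodule ≤ pspan K A) :
    ∃ T ⊆ A, 2 ≤ #T ∧ ∀ x ∈ T, ¬ Q.submodule ≤ pspan K (insert P (A.erase x)) := by
  obtain ⟨T, hTA, hT⟩ := exists_minimal_le_of_wellFoundedLT
    (fun T : Finset (Projectivization K V) => Q.submodule ≤ pspan K T) A hQA
  refine ⟨T, hTA, ?_, fun x hx hQx => ?_⟩
  · by_contra hcard
    obtain h0 | h1 : #T = 0 ∨ #T = 1 := by omega
    · have := hT.prop
      rw [card_eq_zero.mp h0, pspan_empty] at this
      exact not_submodule_le_bot Q this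
    · obtain ⟨y, rfl⟩ := card_eq_one.mp h1
      have := hT.prop
      rw [pspan_singleton] at this
      exact hQ (eq_of_submodule_le this ▸ hA (hTA (mem_singleton_self y)))
  · have hsub : insert P (A.erase x) ⊆ S := insert_subset hP ((erase_subset _ _).trans hA)
    have hun : insert P (A.erase x) ∪ T ⊆ insert P A :=
      union_subset (insert_subset_insert _ (erase_subset _ _)) (hTA.trans (subset_insert _ _))
    have hle := le_inf hQx hT.prop
    rw [hS.pspan_inf hsub (hTA.trans hA)
      ((card_le_card hun).trans (by rw [card_insert_of_notMem hPA, hAr]))] at hle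
    have hxmem := hT.le_of_le hle inter_subset_right hx
    rw [mem_inter, mem_insert] at hxmem
    rcases hxmem.1 with rfl | h
    · exact hPA (hTA hx)
    · exact notMem_erase _ _ h

open Classical in
/-- A point outside `S` lies on strictly fewer hyperplanes of the configuration of `S` than a
point of `S` does. -/
lemma InGenLinPos.card_filter_submodule_le_lt (hS : InGenLinPos K r S) (hr : 1 ≤ r)
    {Q P : Projectivization K V} (hQ : Q ∉ S) (hP : P ∈ S)
    {A : Finset (Projectivization K V)} (hA : A ∈ powersetCard r S) (hPA : P ∉ A)
    (hQA : Q.submodule ≤ pspan K A) :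
    #{B ∈ powersetCard r S | Q.submodule ≤ pspan K B} < #{B ∈ powersetCard r S | P ∈ B} := by
  set F := {B ∈ powersetCard r S | Q.submodule ≤ pspan K B} with hF
  set N := {B ∈ powersetCard r S | P ∈ B} with hN
  have hcount : #(F \ N) * 2 ≤ #(N \ F) * 1 := by
    refine card_mul_le_card_mul (fun B C => C.erase P ⊆ B) (fun B hB => ?_) (fun C hC => ?_)
    · simp only [hF, hN, mem_sdiff, mem_filter, mem_powersetCard, not_and] at hB
      obtain ⟨⟨⟨hBS, hBr⟩, hQB⟩, hPB⟩ := hB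
      replace hPB := hPB ⟨hBS, hBr⟩
      obtain ⟨T, hTB, hT2, hT⟩ := hS.exists_nontrivial_support hQ hP hBS hBr hPB hQB
      refine hT2.trans (card_le_card_of_injOn (fun x => insert P (B.erase x)) ?_ ?_)
      · intro x hx
        have hPx : P ∉ B.erase x := fun h => hPB (mem_of_mem_erase h)
        have hcard : #(insert P (B.erase x)) = r := by
          rw [card_insert_of_notMem hPx, card_erase_of_mem (hTB hx)]
          omega
        simp only [coe_bipartiteAbove, Set.mem_ofPred_eq, hF, hN, mem_sdiff, mem_filter,
          mem_powersetCard, not_and, erase_insert hPx]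
        exact ⟨⟨⟨⟨insert_subset hP ((erase_subset _ _).trans hBS), hcard⟩,
          mem_insert_self _ _⟩, fun _ => hT x hx⟩, erase_subset _ _⟩
      · intro x hx y hy hxy
        by_contra hne
        have hmem : x ∈ insert P (B.erase y) :=
          mem_insert_of_mem (mem_erase.mpr ⟨hne, hTB hx⟩)
        rw [← show insert P (B.erase x) = insert P (B.erase y) from hxy, mem_insert] at hmem
        rcases hmem with rfl | h
        · exact hPB (hTB hx)
        · exact notMem_erase _ _ h
    · simp only [hF, hN, mem_sdiff, mem_filter, mem_powersetCard, not_and] at hC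
      obtain ⟨⟨⟨hCS, hCr⟩, hPC⟩, hQC⟩ := hC
      replace hQC := hQC ⟨hCS, hCr⟩
      refine card_le_one.mpr fun B₁ h₁ B₂ h₂ => ?_
      simp only [mem_bipartiteBelow, hF, mem_sdiff, mem_filter, mem_powersetCard] at h₁ h₂
      obtain ⟨⟨⟨⟨hS₁, hr₁⟩, hQ₁⟩, -⟩, hD₁⟩ := h₁
      obtain ⟨⟨⟨⟨hS₂, hr₂⟩, hQ₂⟩, -⟩, hD₂⟩ := h₂
      by_contra hne
      have hD : #(C.erase P) = r - 1 := by rw [card_erase_of_mem hPC, hCr]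
      have hlt : #(B₁ ∩ B₂) < r := by
        by_contra hge
        have e₁ := eq_of_subset_of_card_le (inter_subset_left (s₁ := B₁) (s₂ := B₂)) (by omega)
        have e₂ := eq_of_subset_of_card_le (inter_subset_right (s₁ := B₁) (s₂ := B₂)) (by omega)
        exact hne (e₁.symm.trans e₂)
      have hDI : C.erase P = B₁ ∩ B₂ :=
        eq_of_subset_of_card_le (subset_inter hD₁ hD₂) (by omega)
      have hcard := card_union_add_card_inter B₁ B₂
      rw [← hDI] at hcard
      have hle := le_inf hQ₁ hQ₂
      rw [hS.pspan_inf hS₁ hS₂ (by omega), ← hDI] at hle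
      exact hQC (hle.trans (pspan_mono (erase_subset _ _)))
  have hpos : 0 < #(F \ N) :=
    card_pos.mpr ⟨A, mem_sdiff.mpr ⟨mem_filter.mpr ⟨hA, hQA⟩, fun h => hPA (mem_filter.mp h).2⟩⟩
  have h1 := card_sdiff_add_card_inter F N
  have h2 := card_sdiff_add_card_inter N F
  rw [inter_comm] at h2
  omega

lemma card_filter_mem_powersetCard_add_choose {α : Type*} [DecidableEq α] (r : ℕ)
    {S : Finset α} {a : α} (ha : a ∈ S) :
    #{B ∈ powersetCard r S | a ∈ B} + (#S - 1).choose r = (#S).choose r := by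
  rw [← card_powersetCard r S, ← card_filter_add_card_filter_not (s := powersetCard r S)
      (fun B => a ∈ B),
    ← card_erase_of_mem ha, ← card_powersetCard r (S.erase a)]
  congr 2
  ext B
  simp only [mem_powersetCard, mem_filter, subset_erase]
  tauto

open Classical in
lemma InGenLinPos.card_filter_image_pspan (hS : InGenLinPos K r S) (Q : Projectivization K V) :
    #{M ∈ (powersetCard r S).image (pspan K) | Q.submodule ≤ M} =
      #{B ∈ powersetCard r S | Q.submodule ≤ pspan K B} := by
  rw [filter_image, card_image_of_injOn]
  exact hS.pspan_injOn.mono (coe_subset.mpr (filter_subset _ _))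

end GenLinPos

theorem recover_points_from_hyperplane_configuration
    {K V : Type*} [Field K] [AddCommGroup V] [Module K V]
    (r t : ℕ) (hr : 1 ≤ r) (ht : r + 1 ≤ t)
    (hdim : Module.finrank K V = r + 1)
    (S S' : Finset (Projectivization K V))
    (hScard : S.card = t) (hS'card : S'.card = t)
    (hS : InGenLinPos K r S) (hS' : InGenLinPos K r S')
    (hconfig : {M : Submodule K V | ∃ A ⊆ S, A.card = r ∧ pspan K A = M} =
      {M : Submodule K V | ∃ A' ⊆ S', A'.card = r ∧ pspan K A' = M}) :
    S = S' := by
  classical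
  have : FiniteDimensional K V := Module.finite_of_finrank_eq_succ hdim
  refine (Finset.eq_of_subset_of_card_le (fun Q hQ' => ?_) (by omega)).symm
  by_contra hQ
  have himage : (Finset.powersetCard r S).image (pspan K) =
      (Finset.powersetCard r S').image (pspan K) := by
    ext M
    simpa only [Set.mem_ofPred_eq, Finset.mem_image, Finset.mem_powersetCard, and_assoc] using
      Set.ext_iff.mp hconfig M
  have hmem : {B ∈ Finset.powersetCard r S' | Q.submodule ≤ pspan K B} =
      {B ∈ Finset.powersetCard r S' | Q ∈ B} :=
    Finset.filter_congr fun B hB => by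
      rw [Finset.mem_powersetCard] at hB
      exact hS'.submodule_le_pspan_iff hB.1 hB.2.le hQ'
  have hcard := hS.card_filter_image_pspan Q
  rw [himage, hS'.card_filter_image_pspan Q, hmem] at hcard
  obtain ⟨B, hQB, hBS', hBr⟩ := Finset.exists_subsuperset_card_eq
    (Finset.singleton_subset_iff.mpr hQ') (by simpa using hr) (by omega : r ≤ S'.card)
  obtain ⟨A, hAS, hAr, hAB⟩ : pspan K B ∈
      {M : Submodule K V | ∃ A ⊆ S, A.card = r ∧ pspan K A = M} :=
    hconfig ▸ ⟨B, hBS', hBr, rfl⟩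
  obtain ⟨P, hP, hPA⟩ := Finset.exists_mem_notMem_of_card_lt_card (by omega : A.card < S.card)
  have hlt := hS.card_filter_submodule_le_lt hr hQ hP
    (Finset.mem_powersetCard.mpr ⟨hAS, hAr⟩) hPA
    (hAB ▸ submodule_le_pspan (Finset.singleton_subset_iff.mp hQB))
  have h1 := card_filter_mem_powersetCard_add_choose r hP
  have h2 := card_filter_mem_powersetCard_add_choose r hQ'
  rw [hScard] at h1
  rw [hS'card] at h2
  omega
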